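/- arXiv:math/9909052 — 3 statements merged into one kernel-verified Lean document; each statement's English description precedes it below -/
import Mathlib

section
/- Let B be a finite set of odd cardinality n ≥ 5 and let A = Alt(B) be the alternating group acting on Q_B (even-cardinality subsets under symmetric difference). Then the only nonzero A-invariant F₂-subspace of Q_B is Q_B itself; i.e., Q_B is a simple F₂[A]-module. -/
/-- The F₂-vector space of even-cardinality subsets of `B`, modeled as the
subspace of functions `B → F₂` whose values sum to `0`. -/
def QB (B : Type*) [Fintype B] : Submodule (ZMod 2) (B → ZMod 2) :=
  LinearMap.ker (∑ x : B, LinearMap.proj x)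

/-- The linear action of a permutation `s` of `B` on `F₂^B`. -/
def permMap {B : Type*} (s : Equiv.Perm B) :
    (B → ZMod 2) →ₗ[ZMod 2] (B → ZMod 2) where
  toFun φ := fun x => φ (s.symm x)
  map_add' _ _ := rfl
  map_smul' _ _ := rfl

theorem QB_cycle_mem {B : Type*} [Fintype B] [DecidableEq B]
    (U : Submodule (ZMod 2) (B → ZMod 2))
    (hinv : ∀ s ∈ alternatingGroup B, U.map (permMap s) = U)
    {a b c : B} (hab : a ≠ b) (hbc : b ≠ c) {f : B → ZMod 2} (hf : f ∈ U) :
    (fun x => f (Equiv.swap a b (Equiv.swap b c x))) ∈ U := by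
  have hs : (Equiv.swap b c * Equiv.swap a b) ∈ alternatingGroup B := by
    rw [Equiv.Perm.mem_alternatingGroup, Equiv.Perm.sign_mul, Equiv.Perm.sign_swap hab,
      Equiv.Perm.sign_swap hbc]
    rfl
  rw [← hinv _ hs]
  exact ⟨f, hf, rfl⟩

theorem QB_zmod_two (x : ZMod 2) : x = 0 ∨ x = 1 := by
  revert x; decide

/-- For `|B| = n` odd, `n ≥ 5`, the only nonzero subspace of `Q_B` invariant
under the alternating group `Alt(B)` is `Q_B` itself: `Q_B` is a simple
`F₂[Alt(B)]`-module. -/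
theorem QB_simple_alternating (B : Type*) [Fintype B] [DecidableEq B]
    (hodd : Odd (Fintype.card B)) (h5 : 5 ≤ Fintype.card B)
    (U : Submodule (ZMod 2) (B → ZMod 2)) (hU : U ≤ QB B)
    (hinv : ∀ s ∈ alternatingGroup B, U.map (permMap s) = U) :
    U = ⊥ ∨ U = QB B := by
  classical
  by_cases hbot : U = ⊥
  · exact Or.inl hbot
  right
  obtain ⟨f, hf, hf0⟩ := (Submodule.ne_bot_iff U).1 hbot
  have hsum : ∀ g ∈ QB B, ∑ x, g x = 0 := by
    intro g hg
    simpa [QB] using hg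
  obtain ⟨a, ha⟩ : ∃ a, f a = 1 := by
    by_contra! h
    exact hf0 (funext fun x => (QB_zmod_two (f x)).resolve_right (h x))
  obtain ⟨b, hb⟩ : ∃ b, f b = 0 := by
    by_contra! h
    have h1 : ∀ x, f x = 1 := fun x => (QB_zmod_two (f x)).resolve_left (h x)
    have h2 := hsum f (hU hf)
    simp only [h1, Finset.sum_const, Finset.card_univ, nsmul_eq_mul, mul_one] at h2
    rw [ZMod.natCast_eq_zero_iff_even] at h2
    exact (Nat.not_even_iff_odd.2 hodd) h2
  have hab : a ≠ b := by
    rintro rfl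
    rw [ha] at hb
    exact one_ne_zero hb
  have third : ∀ x y : B, ∃ z, z ≠ x ∧ z ≠ y := by
    intro x y
    have : ∃ z, z ∉ ({x, y} : Finset B) := by
      by_contra! h
      have h1 : (Finset.univ : Finset B) ⊆ {x, y} := fun z _ => h z
      have h2 := Finset.card_le_card h1
      have h3 := Finset.card_le_two (a := x) (b := y)
      rw [Finset.card_univ] at h2
      omega
    simpa using this
  let R : B → B → Prop := fun x y =>
    (Pi.single x 1 + Pi.single y 1 : B → ZMod 2) ∈ U
  have two : ∀ u : B → ZMod 2, u + u = 0 := fun u => funext fun x => CharTwo.add_self_eq_zero (u x)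
  have Rrefl : ∀ x, R x x := by
    intro x
    change _ ∈ U
    rw [two]
    exact U.zero_mem
  have Rsymm : ∀ x y, R x y → R y x := by
    intro x y h
    change _ ∈ U
    rw [add_comm]
    exact h
  have Rtrans : ∀ x y z, R x y → R y z → R x z := by
    intro x y z h1 h2
    have h3 := U.add_mem h1 h2
    change _ ∈ U
    convert h3 using 1
    rw [add_assoc, ← add_assoc (Pi.single y 1), two, zero_add]
  have Rstep : ∀ x y z, x ≠ y → z ≠ x → z ≠ y → R x y → R x z := by
    intro x y z hxy hzx hzy h
    apply Rsymm
    have h1 := QB_cycle_mem U hinv hxy hzy.symm h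
    change _ ∈ U
    convert h1 using 1
    funext w
    simp only [Pi.add_apply, Pi.single_apply, Equiv.swap_apply_def]
    grind
  have Rne : ∃ x y, x ≠ y ∧ R x y := by
    obtain ⟨c, hca, hcb⟩ := third a b
    have h1 := U.add_mem hf (QB_cycle_mem U hinv hab hcb.symm hf)
    have h11 : (1 : ZMod 2) + 1 = 0 := by decide
    rcases QB_zmod_two (f c) with hc | hc
    · refine ⟨a, c, hca.symm, ?_⟩
      change _ ∈ U
      convert h1 using 1
      funext w
      have := CharTwo.add_self_eq_zero (f w)
      simp only [Pi.add_apply, Pi.single_apply, Equiv.swap_apply_def]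
      grind
    · refine ⟨a, b, hab, ?_⟩
      change _ ∈ U
      convert h1 using 1
      funext w
      have := CharTwo.add_self_eq_zero (f w)
      simp only [Pi.add_apply, Pi.single_apply, Equiv.swap_apply_def]
      grind
  obtain ⟨p, q, hpq, hR⟩ := Rne
  have Rp : ∀ z, R z p := by
    intro z
    apply Rsymm
    by_cases h1 : z = p
    · rw [h1]; exact Rrefl p
    by_cases h2 : z = q
    · rw [h2]; exact hR
    exact Rstep p q z hpq h1 h2 hR
  apply le_antisymm hU
  intro g hg
  have hg0 := hsum g hg
  have key : g = ∑ x, g x • (Pi.single x 1 + Pi.single p 1 : B → ZMod 2) := by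
    simp only [smul_add, Finset.sum_add_distrib]
    rw [← Finset.sum_smul, hg0, zero_smul, add_zero]
    funext w
    simp [Finset.sum_apply, Pi.single_apply]
  rw [key]
  exact U.sum_mem fun x _ => U.smul_mem _ (Rp x)
end

section
/- Let B be a finite set of odd cardinality n ≥ 5 and A = Alt(B) acting on Q_B. Then the algebra of A-equivariant F₂-linear endomorphisms of Q_B equals F₂·Id. -/
theorem permMap_mem_QB {B : Type*} [Fintype B] (s : Equiv.Perm B) :
    ∀ x ∈ QB B, permMap s x ∈ QB B := by
  intro φ hφ
  simp only [QB, LinearMap.mem_ker, LinearMap.sum_apply, LinearMap.proj_apply,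
    permMap, LinearMap.coe_mk, AddHom.coe_mk] at *
  rw [Equiv.sum_comp s.symm φ]
  exact hφ

/-- The induced action of a permutation on `Q_B`. -/
def permQB {B : Type*} [Fintype B] (s : Equiv.Perm B) :
    Module.End (ZMod 2) (QB B) :=
  (permMap s).restrict (permMap_mem_QB s)

/-- The two-element set `{a, b}` as an element of `QB B` (zero when `a = b`). -/
def pairQB {B : Type*} [Fintype B] [DecidableEq B] (a b : B) : QB B :=
  ⟨Pi.single a 1 + Pi.single b 1, by
    simp only [QB, LinearMap.mem_ker, LinearMap.sum_apply, LinearMap.proj_apply, Pi.add_apply,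
      Finset.sum_add_distrib, Finset.mem_univ, if_true, Pi.single_apply,
      Finset.sum_ite_eq']
    decide⟩

theorem pairQB_apply {B : Type*} [Fintype B] [DecidableEq B] (a b x : B) :
    (pairQB a b : B → ZMod 2) x = (if x = a then 1 else 0) + (if x = b then 1 else 0) := by
  simp [pairQB, Pi.single_apply]

theorem permQB_apply {B : Type*} [Fintype B] (s : Equiv.Perm B) (f : QB B) (x : B) :
    (permQB s f : B → ZMod 2) x = (f : B → ZMod 2) (s.symm x) := rfl

theorem sum_QB {B : Type*} [Fintype B] (f : QB B) : ∑ x, (f : B → ZMod 2) x = 0 := by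
  have h := f.2
  simpa only [QB, LinearMap.mem_ker, LinearMap.sum_apply, LinearMap.proj_apply] using h

theorem permQB_pairQB {B : Type*} [Fintype B] [DecidableEq B] (s : Equiv.Perm B) (a b : B) :
    permQB s (pairQB a b) = pairQB (s a) (s b) := by
  ext x
  simp only [permQB_apply, pairQB_apply, Equiv.symm_apply_eq]

theorem pairQB_comm {B : Type*} [Fintype B] [DecidableEq B] (a b : B) :
    pairQB a b = pairQB b a := by
  ext x
  simp only [pairQB_apply, add_comm]

theorem pairQB_self {B : Type*} [Fintype B] [DecidableEq B] (a : B) :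
    pairQB a a = 0 := by
  ext x
  simp only [pairQB_apply]
  exact CharTwo.add_self_eq_zero _

theorem pairQB_add {B : Type*} [Fintype B] [DecidableEq B] (a b c : B) :
    pairQB a b + pairQB a c = pairQB b c := by
  ext x
  simp only [Submodule.coe_add, Pi.add_apply, pairQB_apply]
  rw [add_add_add_comm, CharTwo.add_self_eq_zero, zero_add]

theorem QB_eq_sum {B : Type*} [Fintype B] [DecidableEq B] (a : B) (f : QB B) :
    f = ∑ x, (f : B → ZMod 2) x • pairQB a x := by
  ext y
  simp only [Submodule.coe_sum, Finset.sum_apply, Submodule.coe_smul, Pi.smul_apply, pairQB_apply,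
    smul_eq_mul, mul_add, Finset.sum_add_distrib, mul_ite, mul_one, mul_zero,
    Finset.sum_ite_eq, Finset.mem_univ, if_true]
  by_cases hy : y = a
  · simp only [if_pos hy, sum_QB, zero_add]
  · simp only [if_neg hy, Finset.sum_const_zero, zero_add]

/-- Some element outside a list of at most four given ones. -/
theorem exists_avoid {B : Type*} [Fintype B] [DecidableEq B] (h5 : 5 ≤ Fintype.card B)
    (a b c d : B) : ∃ x, x ≠ a ∧ x ≠ b ∧ x ≠ c ∧ x ≠ d := by
  have h : ({a, b, c, d} : Finset B).card < Fintype.card B :=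
    lt_of_le_of_lt Finset.card_le_four h5
  obtain ⟨x, hx⟩ := Finset.exists_mem_notMem_of_card_lt_card
    (s := ({a, b, c, d} : Finset B)) (t := Finset.univ) (by simpa using h)
  exact ⟨x, by simpa using hx.2⟩

theorem swap_mul_swap_mem {B : Type*} [Fintype B] [DecidableEq B] {a b c d : B}
    (hab : a ≠ b) (hcd : c ≠ d) :
    Equiv.swap a b * Equiv.swap c d ∈ alternatingGroup B := by
  rw [Equiv.Perm.mem_alternatingGroup, map_mul, Equiv.Perm.sign_swap hab,
    Equiv.Perm.sign_swap hcd]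
  rfl

theorem image_pair {B : Type*} [Fintype B] [DecidableEq B]
    (hodd : Odd (Fintype.card B)) (h5 : 5 ≤ Fintype.card B)
    (φ : Module.End (ZMod 2) (QB B))
    (hcomm : ∀ s ∈ alternatingGroup B, φ * permQB s = permQB s * φ) (a b : B) :
    ∃ t : ZMod 2, φ (pairQB a b) = t • pairQB a b := by
  by_cases hab : a = b
  · subst hab
    exact ⟨0, by simp [pairQB_self]⟩
  set v := φ (pairQB a b) with hv
  have key : ∀ s ∈ alternatingGroup B, permQB s (pairQB a b) = pairQB a b →
      ∀ x, (v : B → ZMod 2) (s x) = (v : B → ZMod 2) x := by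
    intro s hs hfix x
    have h := LinearMap.congr_fun (hcomm s hs) (pairQB a b)
    simp only [Module.End.mul_apply, hfix] at h
    have h2 := congrArg (fun w : QB B => (w : B → ZMod 2) (s x)) h
    simpa only [permQB_apply, Equiv.symm_apply_apply] using h2
  have hvab : (v : B → ZMod 2) b = (v : B → ZMod 2) a := by
    obtain ⟨c, hca, hcb, -, -⟩ := exists_avoid h5 a b a b
    obtain ⟨d, hda, hdb, hdc, -⟩ := exists_avoid h5 a b c c
    have hsa : (Equiv.swap a b * Equiv.swap c d) a = b := by
      rw [Equiv.Perm.mul_apply, Equiv.swap_apply_of_ne_of_ne hca.symm hda.symm,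
        Equiv.swap_apply_left]
    have hsb : (Equiv.swap a b * Equiv.swap c d) b = a := by
      rw [Equiv.Perm.mul_apply, Equiv.swap_apply_of_ne_of_ne hcb.symm hdb.symm,
        Equiv.swap_apply_right]
    have := key _ (swap_mul_swap_mem hab hdc.symm)
      (by rw [permQB_pairQB, hsa, hsb, pairQB_comm]) a
    rwa [hsa] at this
  have hvcd : ∀ c d, c ≠ a → c ≠ b → d ≠ a → d ≠ b →
      (v : B → ZMod 2) d = (v : B → ZMod 2) c := by
    intro c d hca hcb hda hdb
    by_cases hcd : c = d
    · rw [hcd]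
    obtain ⟨f, hfa, hfb, hfc, hfd⟩ := exists_avoid h5 a b c d
    have hs : ∀ x, x ≠ c → x ≠ d → x ≠ f → (Equiv.swap d f * Equiv.swap c f) x = x := by
      intro x h1 h2 h3
      rw [Equiv.Perm.mul_apply, Equiv.swap_apply_of_ne_of_ne h1 h3,
        Equiv.swap_apply_of_ne_of_ne h2 h3]
    have := key _ (swap_mul_swap_mem hfd.symm hfc.symm)
      (by rw [permQB_pairQB, hs a hca.symm hda.symm hfa.symm,
        hs b hcb.symm hdb.symm hfb.symm]) c
    rwa [Equiv.Perm.mul_apply, Equiv.swap_apply_left, Equiv.swap_apply_right] at this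
  obtain ⟨c, hca, hcb, -, -⟩ := exists_avoid h5 a b a b
  have hform : ∀ x, (v : B → ZMod 2) x = (v : B → ZMod 2) c +
      ((v : B → ZMod 2) a + (v : B → ZMod 2) c) * (pairQB a b : B → ZMod 2) x := by
    intro x
    rw [pairQB_apply]
    by_cases hxa : x = a
    · subst hxa
      rw [if_pos rfl, if_neg hab, add_zero, mul_one, add_left_comm, CharTwo.add_self_eq_zero,
        add_zero]
    by_cases hxb : x = b
    · subst hxb
      rw [if_pos rfl, if_neg hxa, zero_add, mul_one, add_left_comm, CharTwo.add_self_eq_zero,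
        add_zero, hvab]
    · rw [if_neg hxa, if_neg hxb, hvcd c x hca hcb hxa hxb, add_zero, mul_zero, add_zero]
  have hc0 : (v : B → ZMod 2) c = 0 := by
    have h := sum_QB v
    rw [Finset.sum_congr rfl (fun x _ => hform x), Finset.sum_add_distrib, ← Finset.mul_sum,
      sum_QB, mul_zero, add_zero, Finset.sum_const, Finset.card_univ, nsmul_eq_mul,
      (ZMod.natCast_eq_one_iff_odd).2 hodd, one_mul] at h
    exact h
  refine ⟨(v : B → ZMod 2) a, ?_⟩
  ext x
  rw [hform x, hc0, zero_add, add_zero]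
  rfl

theorem end_alternating_QB_eq_scalar (B : Type*) [Fintype B] [DecidableEq B]
    (hodd : Odd (Fintype.card B)) (h5 : 5 ≤ Fintype.card B)
    (φ : Module.End (ZMod 2) (QB B))
    (hcomm : ∀ s ∈ alternatingGroup B, φ * permQB s = permQB s * φ) :
    φ = 0 ∨ φ = 1 := by
  choose t ht using image_pair hodd h5 φ hcomm
  have hcard : 0 < Fintype.card B := by omega
  obtain ⟨a⟩ := Fintype.card_pos_iff.1 hcard
  have hconst : ∀ x y, x ≠ a → y ≠ a → t a x = t a y := by
    intro x y hx hy
    by_cases hxy : x = y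
    · rw [hxy]
    have h := congrArg φ (pairQB_add a x y)
    rw [map_add, ht, ht, ht] at h
    have h1 := congrArg (fun w : QB B => (w : B → ZMod 2) x) h
    have h2 := congrArg (fun w : QB B => (w : B → ZMod 2) y) h
    simp [pairQB_apply, hx, hxy] at h1
    simp [pairQB_apply, hy, Ne.symm hxy] at h2
    rw [h1, h2]
  obtain ⟨b, hb, -⟩ := exists_avoid h5 a a a a
  have hall : φ = t a b • (1 : Module.End (ZMod 2) (QB B)) := by
    refine LinearMap.ext fun f => ?_
    rw [QB_eq_sum a f, map_sum, map_sum]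
    refine Finset.sum_congr rfl fun x _ => ?_
    rw [map_smul, map_smul]
    congr 1
    by_cases hx : x = a
    · rw [hx, pairQB_self, map_zero, map_zero]
    · rw [ht, hconst x b hx hb]
      rfl
  have h01 : ∀ r : ZMod 2, r = 0 ∨ r = 1 := by decide
  rcases h01 (t a b) with h | h
  · left
    rw [hall, h, zero_smul]
  · right
    rw [hall, h, one_smul]
end

section
/- Let B be a finite set of odd cardinality n ≥ 5, G ⊆ Perm(B) a subgroup isomorphic to Sₙ or Aₙ, and R ⊆ End_{F₂}(Q_B) a unital subalgebra with uRu⁻¹ ⊆ R for all u ∈ G. Then either R = F₂·Id or R = End_{F₂}(Q_B). -/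
universe u
set_option linter.style.haveILetI false

/-- standing hypotheses -/
structure GoodRep {Γ : Type*} [Group Γ] {V : Type u} [AddCommGroup V] [Module (ZMod 2) V]
    (ρ : Γ →* Module.End (ZMod 2) V) : Prop where
  simple : ∀ W : Submodule (ZMod 2) V, (∀ g, ∀ w ∈ W, ρ g w ∈ W) → W = ⊥ ∨ W = ⊤
  schur : ∀ f : Module.End (ZMod 2) V, (∀ g, ρ g * f = f * ρ g) →
    f ∈ (⊥ : Subalgebra (ZMod 2) (Module.End (ZMod 2) V))
  small : ∀ (H : Type u) [Group H] [Finite H] (φ : Γ →* H),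
    (Nat.card H ≤ (Module.finrank (ZMod 2) V).factorial ∨
     Nat.card H ≤ (Module.finrank (ZMod 2) V) ^ 2 ∨
     Nat.card H ≤ 2 ^ (Module.finrank (ZMod 2) V)) → ∀ g, φ g = 1

section
variable {Γ : Type*} [Group Γ] {V : Type u} [AddCommGroup V] [Module (ZMod 2) V]
    (ρ : Γ →* Module.End (ZMod 2) V)

def RStable (R : Subalgebra (ZMod 2) (Module.End (ZMod 2) V)) : Prop :=
  ∀ g, ∀ r ∈ R, ρ g * r * ρ g⁻¹ ∈ R

variable {ρ}

theorem rho_inv_mul (g : Γ) : ρ g⁻¹ * ρ g = 1 := by rw [← map_mul]; simp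
theorem rho_mul_inv (g : Γ) : ρ g * ρ g⁻¹ = 1 := by rw [← map_mul]; simp

theorem rho_inv_mul_assoc (g : Γ) (x) : ρ g⁻¹ * (ρ g * x) = x := by
  rw [← mul_assoc, rho_inv_mul, one_mul]
theorem rho_mul_inv_assoc (g : Γ) (x) : ρ g * (ρ g⁻¹ * x) = x := by
  rw [← mul_assoc, rho_mul_inv, one_mul]

def conjHom {R : Subalgebra (ZMod 2) (Module.End (ZMod 2) V)} (hR : RStable ρ R) :
    Γ →* (R ≃ₐ[ZMod 2] R) where
  toFun g :=
    { toFun := fun r => ⟨ρ g * r * ρ g⁻¹, hR g _ r.2⟩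
      invFun := fun r => ⟨ρ g⁻¹ * r * ρ g, by simpa using hR g⁻¹ _ r.2⟩
      left_inv := fun r => by
        ext1; simp only [mul_assoc, rho_inv_mul_assoc, rho_inv_mul, mul_one]
      right_inv := fun r => by
        ext1; simp only [mul_assoc, rho_mul_inv_assoc, rho_mul_inv, mul_one]
      map_mul' := fun r s => by
        ext1; simp only [mul_assoc, rho_inv_mul_assoc, MulMemClass.coe_mul]
      map_add' := fun r s => by
        ext1; simp only [mul_add, add_mul, AddMemClass.coe_add]
      commutes' := fun r => by
        ext1
        simp only [Subalgebra.coe_algebraMap]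
        rw [(Algebra.commutes r (ρ g)).symm, mul_assoc, rho_mul_inv, mul_one] }
  map_one' := by ext1 r; ext1; simp
  map_mul' g h := by
    ext1 r; ext1; simp [mul_assoc]

theorem conjHom_coe {R : Subalgebra (ZMod 2) (Module.End (ZMod 2) V)} (hR : RStable ρ R)
    (g : Γ) (r : R) : (conjHom hR g r : Module.End (ZMod 2) V) = ρ g * r * ρ g⁻¹ := rfl

theorem conjHom_smul {R : Subalgebra (ZMod 2) (Module.End (ZMod 2) V)} (hR : RStable ρ R)
    (g : Γ) (r : R) (v : V) : ρ g (r • v) = conjHom hR g r • ρ g v := by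
  change ρ g ((r : Module.End (ZMod 2) V) v) = (ρ g * r * ρ g⁻¹) (ρ g v)
  rw [← Module.End.mul_apply, ← Module.End.mul_apply, mul_assoc, rho_inv_mul, mul_one]

theorem eq_bot_of_conj (hρ : GoodRep ρ) {R : Subalgebra (ZMod 2) (Module.End (ZMod 2) V)}
    (hR : RStable ρ R) (h : ∀ g, conjHom hR g = 1) : R = ⊥ := by
  rw [eq_bot_iff]
  intro r hr
  refine hρ.schur r fun g => ?_
  have := congrArg Subtype.val (DFunLike.congr_fun (h g) ⟨r, hr⟩)
  rw [conjHom_coe] at this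
  change ρ g * r * ρ g⁻¹ = r at this
  conv_rhs => rw [← this]
  rw [mul_assoc, mul_assoc, rho_inv_mul, mul_one]

theorem RStable.centralizer {R : Subalgebra (ZMod 2) (Module.End (ZMod 2) V)}
    (hR : RStable ρ R) : RStable ρ (Subalgebra.centralizer (ZMod 2) (R : Set (Module.End (ZMod 2) V))) := by
  intro g c hc
  rw [Subalgebra.mem_centralizer_iff] at hc ⊢
  intro r hr
  have h1 := hc _ (hR g⁻¹ r hr)
  rw [inv_inv] at h1
  have h2 := congrArg (fun x => ρ g * x * ρ g⁻¹) h1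
  simpa only [mul_assoc, rho_inv_mul_assoc, rho_mul_inv_assoc, rho_inv_mul, rho_mul_inv, mul_one] using h2

theorem RStable.inf {R S : Subalgebra (ZMod 2) (Module.End (ZMod 2) V)}
    (hR : RStable ρ R) (hS : RStable ρ S) : RStable ρ (R ⊓ S) :=
  fun g r hr => ⟨hR g r hr.1, hS g r hr.2⟩

/-- torsion of a left ideal stable under conj -/
def tors {R : Subalgebra (ZMod 2) (Module.End (ZMod 2) V)} (J : Ideal R) :
    Submodule (ZMod 2) V where
  carrier := {v | ∀ r ∈ J, r • v = 0}
  add_mem' := fun ha hb r hr => by rw [smul_add, ha r hr, hb r hr, add_zero]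
  zero_mem' := fun r _ => smul_zero r
  smul_mem' := fun c x hx r hr => by rw [smul_comm, hx r hr, smul_zero]

theorem eq_bot_of_tors (hρ : GoodRep ρ) {R : Subalgebra (ZMod 2) (Module.End (ZMod 2) V)}
    (hR : RStable ρ R) (J : Ideal R) (hJ : ∀ g, ∀ r ∈ J, conjHom hR g r ∈ J)
    (hne : tors J ≠ ⊥) : J = ⊥ := by
  rcases hρ.simple (tors J) (fun g w hw r hr => by
    have := conjHom_smul hR g (conjHom hR g⁻¹ r) w
    rw [← AlgEquiv.mul_apply, ← map_mul, mul_inv_cancel, map_one, AlgEquiv.one_apply] at this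
    rw [← this, hw _ (hJ _ _ hr), map_zero]) with h | h
  · exact absurd h hne
  · rw [eq_bot_iff]
    intro r hr
    rw [Ideal.mem_bot]
    ext1; ext1 v
    have : v ∈ tors J := h ▸ Submodule.mem_top
    exact this r hr

theorem semisimple_of_stable [Finite V] [Nontrivial V] (hρ : GoodRep ρ)
    {R : Subalgebra (ZMod 2) (Module.End (ZMod 2) V)}
    (hR : RStable ρ R) : IsSemisimpleRing R := by
  haveI : Finite (Module.End (ZMod 2) V) := Finite.of_injective _ DFunLike.coe_injective
  haveI : Finite R := Subtype.finite
  rw [IsArtinianRing.isSemisimpleRing_iff_jacobson]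
  apply eq_bot_of_tors hρ hR
  · intro g r hr
    haveI : RingHomSurjective ((conjHom hR g : R ≃ₐ[ZMod 2] R) : R →+* R) := ⟨(conjHom hR g).surjective⟩
    exact Ring.le_comap_jacobson ((conjHom hR g : R ≃ₐ[ZMod 2] R) : R →+* R) hr
  · obtain ⟨S, hS, -⟩ := (eq_bot_or_exists_atom_le (⊤ : Submodule R V)).resolve_left top_ne_bot
    haveI : IsSimpleModule R S := isSimpleModule_iff_isAtom.mpr hS
    obtain ⟨s, hs, hs0⟩ := Submodule.exists_mem_ne_zero_of_ne_bot hS.1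
    intro hbot
    apply hs0
    have : s ∈ tors (Ring.jacobson R) := by
      intro r hr
      have := IsSemisimpleModule.jacobson_le_annihilator R S hr
      rw [Module.mem_annihilator] at this
      exact congrArg Subtype.val (this ⟨s, hs⟩)
    rw [hbot] at this
    simpa using this

theorem domain_of_comm [Finite V] [Nontrivial V] (hρ : GoodRep ρ)
    {R : Subalgebra (ZMod 2) (Module.End (ZMod 2) V)}
    (hR : RStable ρ R) (hcomm : ∀ a b : R, a * b = b * a) : IsField R := by
  haveI : Finite (Module.End (ZMod 2) V) := Finite.of_injective _ DFunLike.coe_injective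
  haveI : Finite R := Subtype.finite
  letI : CommRing R := { R.toRing with mul_comm := hcomm }
  let X := {p : Ideal R // p.IsMaximal ∧ tors p ≠ ⊥}
  have key : ∀ g (p : X), (p.1.comap (conjHom hR g⁻¹ : R ≃ₐ[ZMod 2] R)).IsMaximal ∧
      tors (p.1.comap (conjHom hR g⁻¹ : R ≃ₐ[ZMod 2] R)) ≠ ⊥ := by
    intro g p
    refine ⟨(haveI := p.2.1; Ideal.comap_isMaximal_of_equiv _), ?_⟩
    obtain ⟨v, hv, hv0⟩ := Submodule.exists_mem_ne_zero_of_ne_bot p.2.2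
    have : ρ g v ∈ tors (p.1.comap (conjHom hR g⁻¹ : R ≃ₐ[ZMod 2] R)) := by
      intro r hr
      have := conjHom_smul hR g (conjHom hR g⁻¹ r) v
      rw [← AlgEquiv.mul_apply, ← map_mul, mul_inv_cancel, map_one, AlgEquiv.one_apply] at this
      rw [← this, hv _ hr, map_zero]
    intro hbot
    rw [hbot, Submodule.mem_bot] at this
    apply hv0
    have h2 : (ρ g⁻¹ * ρ g) v = 0 := by rw [Module.End.mul_apply, this, map_zero]
    rwa [rho_inv_mul] at h2
  letI : MulAction Γ X :=
    { smul := fun g p => ⟨p.1.comap (conjHom hR g⁻¹ : R ≃ₐ[ZMod 2] R), key g p⟩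
      one_smul := fun p => by
        apply Subtype.ext
        change p.1.comap (conjHom hR 1⁻¹ : R ≃ₐ[ZMod 2] R) = p.1
        ext r
        simp [Ideal.mem_comap]
      mul_smul := fun g h p => by
        apply Subtype.ext
        change p.1.comap (conjHom hR (g * h)⁻¹ : R ≃ₐ[ZMod 2] R) = 
          (p.1.comap (conjHom hR h⁻¹ : R ≃ₐ[ZMod 2] R)).comap (conjHom hR g⁻¹ : R ≃ₐ[ZMod 2] R)
        ext r
        simp [Ideal.mem_comap] }
  haveI : Finite X := Subtype.finite
  haveI := Fintype.ofFinite X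
  classical
  have hcard : Fintype.card X ≤ Module.finrank (ZMod 2) V := by
    have hind : iSupIndep fun p : X => tors p.1 := by
      have h1 : iSupIndep fun p : X => Submodule.torsionBySet R V (p.1 : Set R) := by
        rw [iSupIndep_iff_supIndep_univ]
        apply Submodule.supIndep_torsionBySet_ideal
        intro p _ q _ hpq
        haveI := p.2.1
        haveI := q.2.1
        exact Ideal.isCoprime_iff_sup_eq.mp (Ideal.isCoprime_of_isMaximal (fun h => hpq (Subtype.ext h)))
      have h2 : ∀ p : X, tors p.1 = (Submodule.torsionBySet R V (p.1 : Set R)).restrictScalars (ZMod 2) := by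
        intro p
        ext v
        simp [tors, Submodule.mem_torsionBySet_iff]
      intro p
      simp only [h2, ← Submodule.restrictScalars_iSup]
      rw [disjoint_iff, ← Submodule.restrictScalars_inf, (h1 p).eq_bot, Submodule.restrictScalars_bot]
    have h3 := hind.subtype_ne_bot_le_finrank
    rwa [Fintype.card_congr (Equiv.subtypeUnivEquiv (fun p : X => p.2.2))] at h3
  have hfix := hρ.small (Equiv.Perm X) (MulAction.toPermHom Γ X) (Or.inl (by
    rw [Nat.card_perm, Nat.card_eq_fintype_card]
    exact Nat.factorial_le hcard))
  obtain ⟨p, hp⟩ := associatedPrimes.nonempty R V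
  rw [AssociatedPrimes.mem_iff, isAssociatedPrime_iff] at hp
  obtain ⟨hprime, v, hv⟩ := hp
  haveI := hprime
  have hmax : p.IsMaximal := inferInstance
  have ht : tors p ≠ ⊥ := by
    intro hbot
    have hvt : v ∈ tors p := by
      intro r hr
      rw [hv] at hr
      simpa using hr
    rw [hbot, Submodule.mem_bot] at hvt
    apply hprime.ne_top
    rw [hv, hvt]
    ext; simp
  let P : X := ⟨p, hmax, ht⟩
  have hp0 : p = ⊥ := by
    apply eq_bot_of_tors hρ hR p _ ht
    intro g r hr
    have h1 : g⁻¹ • P = P := Equiv.congr_fun (hfix g⁻¹) P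
    have h2 : p.comap (conjHom hR g⁻¹⁻¹ : R ≃ₐ[ZMod 2] R) = p := congrArg Subtype.val h1
    rw [inv_inv] at h2
    rw [← h2] at hr
    exact hr
  subst hp0
  haveI : IsDomain R := IsDomain.of_bot_isPrime R
  exact Finite.isField_of_domain R
theorem center_bot [Finite V] [Nontrivial V] (hρ : GoodRep ρ)
    {R : Subalgebra (ZMod 2) (Module.End (ZMod 2) V)}
    (hR : RStable ρ R) :
    R ⊓ Subalgebra.centralizer (ZMod 2) (R : Set (Module.End (ZMod 2) V)) = ⊥ := by
  haveI : Finite (Module.End (ZMod 2) V) := Finite.of_injective _ DFunLike.coe_injective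
  have hZ := hR.inf hR.centralizer
  have hf := domain_of_comm hρ hZ (fun a b => by
    ext1
    exact (Subalgebra.mem_centralizer_iff _).mp b.2.2 _ a.2.1)
  apply eq_bot_of_conj hρ hZ
  generalize (R ⊓ Subalgebra.centralizer (ZMod 2) (R : Set (Module.End (ZMod 2) V))) = Z at *
  haveI : Finite Z := Subtype.finite
  letI : Field Z := hf.toField
  haveI : Finite (Z ≃ₐ[ZMod 2] Z) := Finite.of_injective _ DFunLike.coe_injective
  apply hρ.small _ (conjHom hZ) (Or.inr (Or.inl _))
  rw [Nat.card_eq_fintype_card]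
  refine (AlgEquiv.card_le (F := ZMod 2) (K := Z)).trans ?_
  refine (Submodule.finrank_le (Subalgebra.toSubmodule Z)).trans ?_
  rw [Module.finrank_linearMap, sq]

theorem matrix_of_stable [Finite V] [Nontrivial V] (hρ : GoodRep ρ)
    {R : Subalgebra (ZMod 2) (Module.End (ZMod 2) V)}
    (hR : RStable ρ R) : ∃ d, Nonempty (R ≃ₐ[ZMod 2] Matrix (Fin d) (Fin d) (ZMod 2)) := by
  haveI : Finite (Module.End (ZMod 2) V) := Finite.of_injective _ DFunLike.coe_injective
  haveI : Finite R := Subtype.finite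
  haveI := semisimple_of_stable hρ hR
  obtain ⟨n, D, d, _, _, _, hd, ⟨e⟩⟩ :=
    IsSemisimpleRing.exists_algEquiv_pi_matrix_divisionRing_finite (ZMod 2) R
  have hcen : ∀ x : (Π i, Matrix (Fin (d i)) (Fin (d i)) (D i)), (∀ y, y * x = x * y) →
      ∃ c : ZMod 2, x = algebraMap _ _ c := by
    intro x hx
    have h1 : ((e.symm x : R) : Module.End (ZMod 2) V) ∈
        R ⊓ Subalgebra.centralizer (ZMod 2) (R : Set (Module.End (ZMod 2) V)) := by
      refine ⟨(e.symm x).2, (Subalgebra.mem_centralizer_iff _).mpr fun r hr => ?_⟩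
      have := congrArg e.symm (hx (e ⟨r, hr⟩))
      rw [map_mul, map_mul, e.symm_apply_apply] at this
      exact congrArg Subtype.val this
    rw [center_bot hρ hR, Algebra.mem_bot] at h1
    obtain ⟨c, hc⟩ := h1
    refine ⟨c, ?_⟩
    have h2 : e.symm x = algebraMap (ZMod 2) R c := Subtype.ext hc.symm
    rw [← e.apply_symm_apply x, h2, AlgEquiv.commutes]
  have hn : Nonempty (Fin n) := by
    by_contra h
    rw [not_nonempty_iff] at h
    exact one_ne_zero (e.injective (Subsingleton.elim (e (1 : R)) (e 0)))
  obtain ⟨i⟩ := hn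
  have hsub : ∀ j, j = i := by
    intro j
    by_contra hj
    obtain ⟨c, hc⟩ := hcen (Pi.single i 1) (fun y => by
      funext k
      by_cases hk : k = i
      · subst hk; simp
      · simp [hk])
    have h1 := congrFun hc i
    have h2 := congrFun hc j
    have := hd i
    have := hd j
    rw [Pi.single_eq_of_ne hj] at h2
    rw [Pi.single_eq_same] at h1
    have : c = 0 := by
      by_contra hc0
      have hc1 : c = 1 := (by decide : ∀ c : ZMod 2, c ≠ 0 → c = 1) c hc0
      subst hc1
      simp at h2
    subst this
    simp at h1
  haveI : Finite (D i) := Module.finite_of_finite (ZMod 2)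
  letI : Field (D i) := littleWedderburn (D i)
  have hbij : Function.Bijective (Algebra.ofId (ZMod 2) (D i)) := by
    refine ⟨(Algebra.ofId (ZMod 2) (D i)).toRingHom.injective, fun a => ?_⟩
    obtain ⟨c, hc⟩ := hcen (Pi.single i (Matrix.scalar _ a)) (fun y => by
      funext k
      have hk := hsub k
      subst hk
      rw [Pi.mul_apply, Pi.mul_apply, Pi.single_eq_same]
      exact (Matrix.scalar_commute a (fun r' => mul_comm _ _) (y k)).symm)
    refine ⟨c, ?_⟩
    have h1 := congrFun hc i
    have := hd i
    rw [Pi.single_eq_same] at h1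
    have h2 := congrFun (congrFun h1 0) 0
    simp [Matrix.algebraMap_matrix_apply] at h2
    exact h2.symm
  have hev : Function.Bijective (Pi.evalAlgHom (ZMod 2) (fun i => Matrix (Fin (d i)) (Fin (d i)) (D i)) i) := by
    refine ⟨fun x y h => ?_, fun x => ⟨Pi.single i x, by simp⟩⟩
    funext k
    have hk := hsub k
    subst hk
    exact h
  exact ⟨d i, ⟨e.trans ((AlgEquiv.ofBijective _ hev).trans (AlgEquiv.ofBijective _ hbij).symm.mapMatrix)⟩⟩

theorem bot_of_small [Finite V] (hρ : GoodRep ρ)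
    {R : Subalgebra (ZMod 2) (Module.End (ZMod 2) V)}
    (hR : RStable ρ R) {d : ℕ} (e : R ≃ₐ[ZMod 2] Matrix (Fin d) (Fin d) (ZMod 2))
    (hd : d * d ≤ Module.finrank (ZMod 2) V) : R = ⊥ := by
  haveI : Finite (Module.End (ZMod 2) V) := Finite.of_injective _ DFunLike.coe_injective
  haveI : Finite R := Subtype.finite
  haveI : Finite (R ≃ₐ[ZMod 2] R) := Finite.of_injective _ DFunLike.coe_injective
  apply eq_bot_of_conj hρ hR
  apply hρ.small _ (conjHom hR) (Or.inr (Or.inr _))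
  refine le_trans ?_ (Nat.pow_le_pow_right (by norm_num) hd)
  let W := Fin d → ZMod 2
  haveI : Finite (Module.End (ZMod 2) W) := Finite.of_injective _ DFunLike.coe_injective
  let e' : R ≃ₐ[ZMod 2] Module.End (ZMod 2) W := e.trans Matrix.toLinAlgEquiv'
  rw [Nat.card_congr (AlgEquiv.autCongr e').toEquiv]
  haveI : Finite (W ≃ₗ[ZMod 2] W) := Finite.of_injective _ DFunLike.coe_injective
  refine (Nat.card_le_card_of_surjective _ (LinearEquiv.conjAlgEquiv_surjective (ZMod 2) W W)).trans ?_
  refine (Nat.card_le_card_of_injective (fun f : W ≃ₗ[ZMod 2] W => (f : Module.End (ZMod 2) W))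
    LinearEquiv.toLinearMap_injective).trans ?_
  rw [← Nat.card_congr (Matrix.toLinAlgEquiv' (R := ZMod 2) (n := Fin d)).toEquiv]
  simp [Matrix, pow_mul]

theorem abstract_main [Finite V] [Nontrivial V] (hρ : GoodRep ρ)
    {R : Subalgebra (ZMod 2) (Module.End (ZMod 2) V)}
    (hR : RStable ρ R) : R = ⊥ ∨ R = ⊤ := by
  haveI : Finite (Module.End (ZMod 2) V) := Finite.of_injective _ DFunLike.coe_injective
  obtain ⟨d, ⟨e⟩⟩ := matrix_of_stable hρ hR
  have hC := hR.centralizer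
  obtain ⟨c, ⟨e'⟩⟩ := matrix_of_stable hρ hC
  by_cases hd : d * d ≤ Module.finrank (ZMod 2) V
  · exact Or.inl (bot_of_small hρ hR e hd)
  right
  let E : Fin d → Fin d → Module.End (ZMod 2) V := fun i j => (e.symm (Matrix.single i j 1) : R)
  have hER : ∀ i j, E i j ∈ R := fun i j => (e.symm (Matrix.single i j 1)).2
  have hEs : ∀ i j k, E i j * E j k = E i k := by
    intro i j k
    have : e.symm (Matrix.single i j 1) * e.symm (Matrix.single j k 1) = e.symm (Matrix.single i k 1) := by
      rw [← map_mul, Matrix.single_mul_single_same, mul_one]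
    exact congrArg Subtype.val this
  have hEn : ∀ i j k l, j ≠ k → E i j * E k l = 0 := by
    intro i j k l hjk
    have : e.symm (Matrix.single i j 1) * e.symm (Matrix.single k l 1) = 0 := by
      rw [← map_mul, Matrix.single_mul_single_of_ne _ _ _ _ hjk, map_zero]
    exact congrArg Subtype.val this
  have hE1 : ∑ i, E i i = 1 := by
    have : ∑ i, e.symm (Matrix.single i i 1) = 1 := by
      rw [← map_sum, Matrix.sum_single_one, map_one]
    simpa [E] using congrArg Subtype.val this
  have hEgen : ∀ r ∈ R, ∃ m : Fin d → Fin d → ZMod 2, r = ∑ i, ∑ j, m i j • E i j := by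
    intro r hr
    refine ⟨e ⟨r, hr⟩, ?_⟩
    have h1 : (⟨r, hr⟩ : R) = ∑ i, ∑ j, (e ⟨r, hr⟩) i j • e.symm (Matrix.single i j 1) := by
      apply e.injective
      simp only [map_sum, map_smul, AlgEquiv.apply_symm_apply, Matrix.smul_single, smul_eq_mul, mul_one]
      exact Matrix.matrix_eq_sum_single _
    simpa [E] using congrArg Subtype.val h1
  have hcommE : ∀ x ∈ Subalgebra.centralizer (ZMod 2) (R : Set (Module.End (ZMod 2) V)),
      ∀ i j, E i j * x = x * E i j := fun x hx i j =>
    (Subalgebra.mem_centralizer_iff _).mp hx _ (hER i j)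
  have hF : ∀ f : Module.End (ZMod 2) V, ∀ p q, ∑ k, E k p * f * E q k ∈
      Subalgebra.centralizer (ZMod 2) (R : Set (Module.End (ZMod 2) V)) := by
    intro f p q
    rw [Subalgebra.mem_centralizer_iff]
    intro r hr
    obtain ⟨m, rfl⟩ := hEgen r hr
    rw [Finset.sum_mul, Finset.mul_sum]
    refine Finset.sum_congr rfl fun i _ => ?_
    rw [Finset.sum_mul, Finset.mul_sum]
    refine Finset.sum_congr rfl fun j _ => ?_
    rw [smul_mul_assoc, mul_smul_comm]
    congr 1
    rw [Finset.mul_sum, Finset.sum_mul, Finset.sum_eq_single j, Finset.sum_eq_single i]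
    · rw [← mul_assoc, ← mul_assoc, hEs, mul_assoc _ (E q i), hEs]
    · intro k _ hk
      rw [mul_assoc, hEn _ _ _ _ hk, mul_zero]
    · simp
    · intro k _ hk
      rw [← mul_assoc, ← mul_assoc, hEn _ _ _ _ hk.symm, zero_mul, zero_mul]
    · simp
  have hcd : c * c ≤ Module.finrank (ZMod 2) V := by
    set C := Subalgebra.centralizer (ZMod 2) (R : Set (Module.End (ZMod 2) V)) with hCdef
    let Φ : (Fin d × Fin d → C) → Module.End (ZMod 2) V := fun x => ∑ ij, (x ij : Module.End (ZMod 2) V) * E ij.1 ij.2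
    have hΦ : ∀ x p q, ∑ k, E k p * Φ x * E q k = x (p, q) := by
      intro x p q
      have : ∀ k, E k p * Φ x * E q k = (x (p, q) : Module.End (ZMod 2) V) * E k k := by
        intro k
        simp only [Φ, Finset.mul_sum, Finset.sum_mul]
        rw [Finset.sum_eq_single (p, q)]
        · rw [← mul_assoc, hcommE _ (x (p, q)).2, mul_assoc, mul_assoc, hEs, hEs]
        · rintro ⟨i, j⟩ _ hij
          rw [← mul_assoc, hcommE _ (x (i, j)).2, mul_assoc, mul_assoc]
          by_cases hi : i = p
          · have hj : j ≠ q := by rintro rfl; exact hij (by rw [hi])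
            rw [hEn _ _ _ _ hj, mul_zero, mul_zero]
          · rw [← mul_assoc (E k p), hEn _ _ _ _ (Ne.symm hi), zero_mul, mul_zero]
        · simp
      simp only [this, ← Finset.mul_sum, hE1, mul_one]
    have hinj : Function.Injective Φ := by
      intro x y hxy
      funext ⟨p, q⟩
      ext1
      rw [← hΦ, ← hΦ, hxy]
    have hcard := Nat.card_le_card_of_injective Φ hinj
    rw [Nat.card_fun, Nat.card_congr e'.toEquiv,
      Module.natCard_eq_pow_finrank (K := ZMod 2) (V := Module.End (ZMod 2) V),
      Module.natCard_eq_pow_finrank (K := ZMod 2) (V := Matrix (Fin c) (Fin c) (ZMod 2)),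
      Module.finrank_linearMap, Module.finrank_matrix, ← pow_mul] at hcard
    simp at hcard
    have h2 := (Nat.pow_le_pow_iff_right (by norm_num : 1 < 2)).mp hcard
    by_contra hcc
    push Not at hcc hd
    have := Nat.mul_lt_mul'' hcc hd
    omega
  have hCbot := bot_of_small hρ hC e' hcd
  rw [eq_top_iff]
  intro f _
  have hf : f = ∑ p, ∑ q, (∑ k, E k p * f * E q k) * E p q := by
    have : ∀ p q, (∑ k, E k p * f * E q k) * E p q = E p p * f * E q q := by
      intro p q
      rw [Finset.sum_mul, Finset.sum_eq_single p]
      · rw [mul_assoc, hEs]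
      · intro k _ hk
        rw [mul_assoc, hEn _ _ _ _ hk, mul_zero]
      · simp
    simp only [this, ← Finset.mul_sum, ← Finset.sum_mul, hE1, mul_one, one_mul]
  rw [hf]
  refine sum_mem fun p _ => sum_mem fun q _ => mul_mem ?_ (hER p q)
  have := hF f p q
  rw [hCbot] at this
  exact bot_le (a := R) this
end

section concrete
variable {B : Type u} [Fintype B] [DecidableEq B]

theorem mem_QB_iff (w : B → ZMod 2) : w ∈ QB B ↔ ∑ x, w x = 0 := by
  simp [QB, LinearMap.mem_ker, LinearMap.sum_apply]

theorem permQB_coe (s : Equiv.Perm B) (w : QB B) (x : B) :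
    (permQB s w : B → ZMod 2) x = (w : B → ZMod 2) (s.symm x) := rfl

def rhoB : alternatingGroup B →* Module.End (ZMod 2) (QB B) where
  toFun g := permQB (g : Equiv.Perm B)
  map_one' := by ext w x; rfl
  map_mul' g h := by ext w x; rfl

theorem rhoB_coe (s : alternatingGroup B) (w : QB B) (x : B) :
    (rhoB s w : B → ZMod 2) x = (w : B → ZMod 2) ((s : Equiv.Perm B).symm x) := rfl

/-- the pair `{a,b}` -/
def pairB (a b : B) : QB B := ⟨Pi.single a 1 + Pi.single b 1, by
  rw [mem_QB_iff]
  simp [Finset.sum_add_distrib]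
  decide⟩

theorem pairB_coe (a b x : B) : (pairB a b : B → ZMod 2) x =
    (if x = a then 1 else 0) + (if x = b then 1 else 0) := by
  simp [pairB, Pi.single_apply]

theorem zmod2_add_self (x : ZMod 2) : x + x = 0 := CharTwo.add_self_eq_zero x

/-- three-cycle `a → b → c → a` -/
def tcyc (a b c : B) (hab : a ≠ b) (hbc : b ≠ c) : alternatingGroup B :=
  ⟨Equiv.swap a b * Equiv.swap b c, by
    rw [Equiv.Perm.mem_alternatingGroup, map_mul, Equiv.Perm.sign_swap hab, Equiv.Perm.sign_swap hbc]
    rfl⟩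

theorem tcyc_symm (a b c : B) (hab : a ≠ b) (hbc : b ≠ c) (x : B) :
    ((tcyc a b c hab hbc : alternatingGroup B) : Equiv.Perm B).symm x =
      Equiv.swap b c (Equiv.swap a b x) := rfl

theorem tcyc_symm' (a b c : B) (hab : a ≠ b) (hbc : b ≠ c) (hac : a ≠ c) (x : B) :
    ((tcyc a b c hab hbc : alternatingGroup B) : Equiv.Perm B).symm x =
      if x = a then c else if x = b then a else if x = c then b else x := by
  rw [tcyc_symm]
  simp only [Equiv.swap_apply_def]
  grind

theorem dcyc_mem (a b c d : B) (hab : a ≠ b) (hcd : c ≠ d) :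
    Equiv.swap a b * Equiv.swap c d ∈ alternatingGroup B := by
    rw [Equiv.Perm.mem_alternatingGroup, map_mul, Equiv.Perm.sign_swap hab, Equiv.Perm.sign_swap hcd]
    rfl

theorem exists_other (h : 5 ≤ Fintype.card B) (a b c d : B) :
    ∃ e, e ≠ a ∧ e ≠ b ∧ e ≠ c ∧ e ≠ d := by
  have : ∃ e, e ∉ ({a, b, c, d} : Finset B) := by
    by_contra hh
    push Not at hh
    have h1 : (Finset.univ : Finset B) ⊆ {a, b, c, d} := fun x _ => hh x
    have := (Finset.card_le_card h1).trans Finset.card_le_four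
    rw [Finset.card_univ] at this
    omega
  simpa using this

theorem pair_move (a b c : B) (hab : a ≠ b) (hbc : b ≠ c) (hac : a ≠ c) :
    rhoB (tcyc a b c hab hbc) (pairB a b) = pairB b c := by
  ext x
  rw [rhoB_coe, tcyc_symm' _ _ _ _ _ hac, pairB_coe, pairB_coe]
  grind

theorem simpleB (h5 : 5 ≤ Fintype.card B) (hodd : Odd (Fintype.card B))
    (W : Submodule (ZMod 2) (QB B)) (hW : ∀ g, ∀ w ∈ W, rhoB g w ∈ W) : W = ⊥ ∨ W = ⊤ := by
  by_cases hbot : W = ⊥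
  · exact Or.inl hbot
  right
  obtain ⟨w, hw, hw0⟩ := Submodule.exists_mem_ne_zero_of_ne_bot hbot
  have h01 : ∀ x : ZMod 2, x ≠ 0 → x = 1 := by decide
  have hsum := (mem_QB_iff _).mp w.2
  obtain ⟨a, ha⟩ : ∃ a, (w : B → ZMod 2) a = 1 := by
    by_contra h
    push Not at h
    apply hw0
    ext x
    by_contra hx
    exact h x (h01 _ hx)
  obtain ⟨b, hb⟩ : ∃ b, (w : B → ZMod 2) b = 0 := by
    by_contra h
    push Not at h
    have : ∀ x, (w : B → ZMod 2) x = 1 := fun x => h01 _ (h x)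
    simp only [this] at hsum
    simp at hsum
    rw [ZMod.natCast_eq_zero_iff_even] at hsum
    exact (Nat.not_even_iff_odd.mpr hodd) hsum
  have hab : a ≠ b := by rintro rfl; rw [ha] at hb; exact one_ne_zero hb
  obtain ⟨c, hca, hcb, -⟩ := exists_other h5 a b a b
  have hpair : ∃ x y, x ≠ y ∧ pairB x y ∈ W := by
    have hm := W.add_mem hw (hW (tcyc a b c hab hcb.symm) w hw)
    by_cases hc : (w : B → ZMod 2) c = 0
    · refine ⟨a, b, hab, ?_⟩
      convert hm using 1
      ext x
      rw [Submodule.coe_add, Pi.add_apply, rhoB_coe, tcyc_symm' _ _ _ _ _ hca.symm, pairB_coe]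
      have := zmod2_add_self ((w : B → ZMod 2) x)
      grind
    · have hc := h01 _ hc
      refine ⟨b, c, hcb.symm, ?_⟩
      convert hm using 1
      ext x
      rw [Submodule.coe_add, Pi.add_apply, rhoB_coe, tcyc_symm' _ _ _ _ _ hca.symm, pairB_coe]
      have := zmod2_add_self ((w : B → ZMod 2) x)
      have := zmod2_add_self 1
      grind
  obtain ⟨x, y, hxy, hp⟩ := hpair
  have hall : ∀ z, pairB x z ∈ W := by
    intro z
    by_cases hz : z = x
    · subst hz
      convert W.zero_mem using 1
      ext t
      rw [pairB_coe, zmod2_add_self]; rfl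
    by_cases hz' : z = y
    · subst hz'; exact hp
    have h1 := hW (tcyc x y z hxy (Ne.symm hz')) _ hp
    rw [pair_move _ _ _ _ _ (Ne.symm hz)] at h1
    have h2 := hW (tcyc y z x (Ne.symm hz') hz) _ h1
    rw [pair_move _ _ _ _ _ hxy.symm] at h2
    convert h2 using 1
    ext t
    rw [pairB_coe, pairB_coe, add_comm]
  rw [eq_top_iff]
  intro v _
  have hv : v = ∑ z, (v : B → ZMod 2) z • pairB x z := by
    have hs := (mem_QB_iff _).mp v.2
    ext t
    rw [Submodule.coe_sum, Finset.sum_apply]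
    simp only [Submodule.coe_smul, Pi.smul_apply, pairB_coe, smul_eq_mul, mul_add,
      Finset.sum_add_distrib, ← Finset.sum_mul, hs]
    simp
  rw [hv]
  exact sum_mem fun z _ => W.smul_mem _ (hall z)

theorem schurB (h5 : 5 ≤ Fintype.card B) (hodd : Odd (Fintype.card B))
    (f : Module.End (ZMod 2) (QB B)) (hf : ∀ g, rhoB g * f = f * rhoB g) :
    f ∈ (⊥ : Subalgebra (ZMod 2) (Module.End (ZMod 2) (QB B))) := by
  haveI : Nonempty B := Fintype.card_pos_iff.mp (by omega)
  obtain ⟨a⟩ := ‹Nonempty B›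
  obtain ⟨b, hba, -⟩ := exists_other h5 a a a a
  obtain ⟨c, hca, hcb, -⟩ := exists_other h5 a b a b
  set u := f (pairB a b) with hu
  have hfix : ∀ g, rhoB g (pairB a b) = pairB a b → ∀ x,
      (u : B → ZMod 2) ((g : Equiv.Perm B).symm x) = (u : B → ZMod 2) x := by
    intro g hg x
    rw [← rhoB_coe, hu, ← Module.End.mul_apply, hf, Module.End.mul_apply, hg]
  have h1 : ∀ d, d ≠ a → d ≠ b → (u : B → ZMod 2) d = (u : B → ZMod 2) c := by
    intro d hda hdb
    by_cases hdc : d = c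
    · rw [hdc]
    obtain ⟨e, hea, heb, hec, hed⟩ := exists_other h5 a b c d
    have := hfix (tcyc d e c (Ne.symm hed) hec) (by
      ext x
      rw [rhoB_coe, tcyc_symm' _ _ _ _ _ hdc, pairB_coe, pairB_coe]
      grind) d
    rw [tcyc_symm' _ _ _ _ _ hdc, if_pos rfl] at this
    exact this.symm
  have h2 : (u : B → ZMod 2) b = (u : B → ZMod 2) a := by
    obtain ⟨d, hda, hdb, hdc, -⟩ := exists_other h5 a b c c
    have := hfix ⟨_, dcyc_mem a b c d hba.symm hdc.symm⟩ (by
      ext x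
      rw [rhoB_coe, pairB_coe, pairB_coe]
      change _ + (if Equiv.swap c d (Equiv.swap a b x) = b then _ else _) = _
      change (if Equiv.swap c d (Equiv.swap a b x) = a then _ else _) + _ = _
      simp only [Equiv.swap_apply_def]
      grind) a
    change (u : B → ZMod 2) (Equiv.swap c d (Equiv.swap a b a)) = _ at this
    rw [Equiv.swap_apply_left, Equiv.swap_apply_of_ne_of_ne hcb.symm hdb.symm] at this
    exact this
  have h3 : (u : B → ZMod 2) c = 0 := by
    have hsum := (mem_QB_iff _).mp (u - ((u : B → ZMod 2) a + (u : B → ZMod 2) c) • pairB a b).2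
    have : ∀ x, ((u - ((u : B → ZMod 2) a + (u : B → ZMod 2) c) • pairB a b : QB B) : B → ZMod 2) x
        = (u : B → ZMod 2) c := by
      intro x
      rw [Submodule.coe_sub, Pi.sub_apply, Submodule.coe_smul, Pi.smul_apply, pairB_coe, smul_eq_mul]
      have := zmod2_add_self ((u : B → ZMod 2) c)
      grind
    simp only [this] at hsum
    have hn : ((Fintype.card B : ℕ) : ZMod 2) = 1 := ZMod.natCast_eq_one_iff_odd.mpr hodd
    simpa [hn] using hsum
  set α := (u : B → ZMod 2) a with hα
  have h4 : u = α • pairB a b := by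
    ext x
    rw [Submodule.coe_smul, Pi.smul_apply, pairB_coe, smul_eq_mul]
    have := h1 x
    grind
  rw [Algebra.mem_bot]
  refine ⟨α, ?_⟩
  rcases simpleB h5 hodd (LinearMap.ker (f - algebraMap (ZMod 2) _ α)) (fun g w hw => by
    rw [LinearMap.mem_ker] at hw ⊢
    rw [← Module.End.mul_apply, sub_mul, ← hf, ← (Algebra.commutes α (rhoB g)).symm, ← mul_sub,
      Module.End.mul_apply, hw, map_zero]) with h | h
  · exfalso
    have : pairB a b ∈ LinearMap.ker (f - algebraMap (ZMod 2) _ α) := by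
      rw [LinearMap.mem_ker, LinearMap.sub_apply, ← hu, h4]
      simp
    rw [h, Submodule.mem_bot] at this
    have := congrFun (congrArg Subtype.val this) a
    rw [pairB_coe] at this
    simp [hba.symm] at this
  · rw [LinearMap.ker_eq_top] at h
    exact (sub_eq_zero.mp h).symm

theorem two_pow_lt_fact (n : ℕ) (h : 5 ≤ n) : 2 ^ n < n.factorial := by
  induction n, h using Nat.le_induction with
  | base => decide
  | succ k hk ih =>
    rw [pow_succ, Nat.factorial_succ]
    nlinarith

theorem smallB (h5 : 5 ≤ Fintype.card B) (H : Type u) [Group H] [Finite H]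
    (φ : alternatingGroup B →* H)
    (h : Nat.card H ≤ (Module.finrank (ZMod 2) (QB B)).factorial ∨
     Nat.card H ≤ (Module.finrank (ZMod 2) (QB B)) ^ 2 ∨
     Nat.card H ≤ 2 ^ (Module.finrank (ZMod 2) (QB B))) (g) : φ g = 1 := by
  haveI := alternatingGroup.isSimpleGroup (α := B) (by rwa [Nat.card_eq_fintype_card])
  haveI : Nontrivial B := Fintype.one_lt_card_iff_nontrivial.mp (by omega)
  rcases IsSimpleGroup.eq_bot_or_eq_top_of_normal φ.ker inferInstance with hk | hk
  · exfalso
    have hinj := (MonoidHom.ker_eq_bot_iff φ).mp hk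
    have hc := Nat.card_le_card_of_injective φ hinj
    have h2 := two_mul_nat_card_alternatingGroup (α := B)
    rw [Nat.card_perm, Nat.card_eq_fintype_card (α := B)] at h2
    have hlt : Module.finrank (ZMod 2) (QB B) < Fintype.card B := by
      rw [← Module.finrank_fintype_fun_eq_card (ZMod 2)]
      apply Submodule.finrank_lt
      intro htop
      obtain ⟨a⟩ : Nonempty B := inferInstance
      have : (Pi.single a 1 : B → ZMod 2) ∈ QB B := htop ▸ Submodule.mem_top
      rw [mem_QB_iff] at this
      simp at this
    generalize Module.finrank (ZMod 2) (QB B) = d at *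
    generalize Fintype.card B = n at *
    obtain ⟨m, rfl⟩ : ∃ m, n = m + 1 := ⟨n - 1, by omega⟩
    have hd : d ≤ m := by omega
    have hf := Nat.factorial_succ m
    rcases h with h | h | h
    · have := Nat.factorial_le hd
      have := Nat.factorial_pos m
      nlinarith
    · have h3 : d ^ 2 ≤ m ^ 2 := Nat.pow_le_pow_left hd 2
      have h4 : m ≤ m.factorial := Nat.self_le_factorial m
      have h6 : 2 ≤ (m - 1).factorial := by
        have := Nat.self_le_factorial (m - 1)
        omega
      have h7 : m.factorial = m * (m - 1).factorial := (Nat.mul_factorial_pred (by omega)).symm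
      have h8 : 2 * m ≤ m.factorial := by rw [h7]; nlinarith
      nlinarith
    · have := two_pow_lt_fact (m + 1) h5
      have : 2 ^ d ≤ 2 ^ m := Nat.pow_le_pow_right (by norm_num) hd
      rw [pow_succ] at *
      omega
  · have : g ∈ φ.ker := hk ▸ Subgroup.mem_top g
    exact this

theorem alt_le (n : ℕ) (hn : Fintype.card B = n) (h5 : 5 ≤ n)
    (G : Subgroup (Equiv.Perm B))
    (hG : Nonempty (G ≃* Equiv.Perm (Fin n)) ∨
          Nonempty (G ≃* alternatingGroup (Fin n))) : alternatingGroup B ≤ G := by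
  haveI : Nontrivial B := Fintype.one_lt_card_iff_nontrivial.mp (by omega)
  haveI : Nontrivial (Fin n) := Fin.nontrivial_iff_two_le.mpr (by omega)
  apply Equiv.Perm.alternatingGroup_le_of_index_le_two
  have hmul := G.card_mul_index
  rw [Nat.card_perm, Nat.card_eq_fintype_card (α := B), hn] at hmul
  have hpos := Nat.factorial_pos n
  rcases hG with ⟨⟨e⟩⟩ | ⟨⟨e⟩⟩
  · rw [Nat.card_congr e.toEquiv, Nat.card_perm, Nat.card_fin] at hmul
    nlinarith
  · have h2 := two_mul_nat_card_alternatingGroup (α := Fin n)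
    rw [Nat.card_perm, Nat.card_fin] at h2
    rw [Nat.card_congr e.toEquiv] at hmul
    nlinarith
end concrete

/-- For `|B| = n` odd, `n ≥ 5`: let `G ⊆ Perm(B)` be a subgroup abstractly
isomorphic to `Sₙ` or to `Aₙ`, and let `R` be a unital `F₂`-subalgebra of
`End_{F₂}(Q_B)` with `u R u⁻¹ ⊆ R` for all `u ∈ G`. Then `R = F₂·Id` or
`R = End_{F₂}(Q_B)`. -/
theorem subalgebra_conj_G (B : Type*) [Fintype B] [DecidableEq B] (n : ℕ)
    (hn : Fintype.card B = n) (hodd : Odd n) (h5 : 5 ≤ n)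
    (G : Subgroup (Equiv.Perm B))
    (hG : Nonempty (G ≃* Equiv.Perm (Fin n)) ∨
          Nonempty (G ≃* alternatingGroup (Fin n)))
    (R : Subalgebra (ZMod 2) (Module.End (ZMod 2) (QB B)))
    (hconj : ∀ u ∈ G, ∀ r ∈ R, permQB u * r * permQB u⁻¹ ∈ R) :
    R = ⊥ ∨ R = ⊤ := by
  subst hn
  haveI : Nontrivial B := Fintype.one_lt_card_iff_nontrivial.mp (by omega)
  have hA := alt_le _ rfl h5 G hG
  haveI : Nontrivial (QB B) := by
    obtain ⟨a, b, hab⟩ := exists_pair_ne B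
    refine ⟨pairB a b, 0, fun h => ?_⟩
    have := congrFun (congrArg Subtype.val h) a
    rw [pairB_coe] at this
    simp [hab] at this
  exact abstract_main (ρ := rhoB) ⟨simpleB h5 hodd, schurB h5 hodd, smallB h5⟩
    (fun g r hr => hconj g (hA g.2) r hr)
end
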